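/- arXiv:2209.04315 — 3 statements merged into one kernel-verified Lean document; each statement's English description precedes it below -/
import Mathlib

section
/- Let K be a positive integer, let r_1,…,r_K, θ_1,…,θ_K, λ_1,…,λ_K be real numbers, and let z_1,…,z_K be rationally independent real numbers. Then the time-averaged characteristic function of the sum of sinusoids converges: lim_{T→∞} (1/T) ∫_0^T exp(i Σ_{k=1}^K λ_k r_k cos(θ_k + τ z_k)) dτ = Π_{k=1}^K J₀(λ_k r_k). -/
open MeasureTheory Filter

/-- Bessel function of the first kind of order 0:
`J₀(s) = (1/(2π)) ∫_{−π}^{π} e^{i s cos u} du`. -/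
noncomputable def besselJ0 (s : ℝ) : ℂ :=
  ((2 * Real.pi : ℝ) : ℂ)⁻¹ *
    ∫ u in (-Real.pi)..Real.pi, Complex.exp (Complex.I * ((s * Real.cos u : ℝ) : ℂ))

/-- `z_1,…,z_K` are rationally independent. -/
def RationallyIndependent {K : ℕ} (z : Fin K → ℝ) : Prop :=
  ∀ m : Fin K → ℤ, (∑ k, (m k : ℝ) * z k) = 0 → ∀ k, m k = 0


/-- Product Haar probability measure on the torus. -/
noncomputable def torusMeasure (K : ℕ) : Measure (UnitAddTorus (Fin K)) :=
  Measure.pi (fun _ => (AddCircle.haarAddCircle : Measure UnitAddCircle))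

instance torusMeasure_prob (K : ℕ) : IsProbabilityMeasure (torusMeasure K) := by
  unfold torusMeasure; infer_instance

/-- The linear flow on the torus. -/
noncomputable def torusFlow {K : ℕ} (θ z : Fin K → ℝ) (τ : ℝ) : UnitAddTorus (Fin K) :=
  fun k => (((θ k + τ * z k) / (2 * Real.pi) : ℝ) : UnitAddCircle)

lemma torusFlow_continuous {K : ℕ} (θ z : Fin K → ℝ) : Continuous (torusFlow θ z) := by
  unfold torusFlow
  refine continuous_pi fun k => ?_
  exact (AddCircle.continuous_mk' (1 : ℝ)).comp (by fun_prop)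

lemma integral_fourier_haar (n : ℤ) (hn : n ≠ 0) :
    ∫ x : UnitAddCircle, fourier n x ∂AddCircle.haarAddCircle = 0 :=
  integral_eq_zero_of_add_right_eq_neg (μ := AddCircle.haarAddCircle)
      (fourier_add_half_inv_index hn one_pos)

lemma integral_mFourier_torus {K : ℕ} (n : Fin K → ℤ) (hn : n ≠ 0) :
    ∫ x, UnitAddTorus.mFourier n x ∂(torusMeasure K) = 0 := by
  obtain ⟨i, hi⟩ := Function.ne_iff.mp hn
  have := integral_fintype_prod_eq_prod (𝕜 := ℂ)
    (fun i (x : UnitAddCircle) => (fourier (n i) x : ℂ))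
    (μ := fun _ : Fin K => (AddCircle.haarAddCircle : Measure UnitAddCircle))
  refine this.trans ?_
  exact Finset.prod_eq_zero (Finset.mem_univ i) (integral_fourier_haar _ hi)

lemma mFourier_flow {K : ℕ} (θ z : Fin K → ℝ) (n : Fin K → ℤ) (τ : ℝ) :
    UnitAddTorus.mFourier n (torusFlow θ z τ) =
      Complex.exp (Complex.I * ((∑ k, (n k : ℝ) * θ k : ℝ) : ℂ)) *
      Complex.exp ((Complex.I * ((∑ k, (n k : ℝ) * z k : ℝ) : ℂ)) * τ) := by
  have hpi : (Real.pi : ℂ) ≠ 0 := by exact_mod_cast Real.pi_ne_zero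
  simp only [UnitAddTorus.mFourier, ContinuousMap.coe_mk, torusFlow]
  simp_rw [fourier_coe_apply]
  rw [← Complex.exp_sum, ← Complex.exp_add]
  congr 1
  push_cast
  rw [Finset.mul_sum, Finset.mul_sum, Finset.sum_mul, ← Finset.sum_add_distrib]
  refine Finset.sum_congr rfl fun k _ => ?_
  field_simp

/-- Time averages converge to space averages. -/
def Equidistributes {K : ℕ} (θ z : Fin K → ℝ) (f : C(UnitAddTorus (Fin K), ℂ)) : Prop :=
  Tendsto (fun T : ℝ => (T : ℂ)⁻¹ * ∫ τ in (0 : ℝ)..T, f (torusFlow θ z τ)) atTop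
    (nhds (∫ x, f x ∂(torusMeasure K)))

lemma equi_mFourier {K : ℕ} (θ z : Fin K → ℝ) (hz : RationallyIndependent z) (n : Fin K → ℤ) :
    Equidistributes θ z (UnitAddTorus.mFourier n) := by
  unfold Equidistributes
  by_cases hn : n = 0
  · subst hn
    rw [UnitAddTorus.mFourier_zero]
    refine Tendsto.congr' ?_ tendsto_const_nhds
    filter_upwards [eventually_gt_atTop 0] with T hT
    have : (T : ℂ) ≠ 0 := by exact_mod_cast hT.ne'
    simp [this]
  · rw [integral_mFourier_torus n hn]
    set w : ℝ := ∑ k, (n k : ℝ) * z k with hw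
    have hw0 : w ≠ 0 := fun h => hn (funext (hz n h))
    have hc : Complex.I * (w : ℂ) ≠ 0 :=
      mul_ne_zero Complex.I_ne_zero (by exact_mod_cast hw0)
    simp_rw [mFourier_flow, intervalIntegral.integral_const_mul]
    rw [← hw]
    simp_rw [integral_exp_mul_complex hc]
    have hb : Tendsto (fun T : ℝ => T⁻¹ * (2 / |w|)) atTop (nhds 0) := by
      simpa using tendsto_inv_atTop_zero.mul_const (2 / |w|)
    refine squeeze_zero_norm' ?_ hb
    filter_upwards [eventually_gt_atTop 0] with T hT
    rw [norm_mul, norm_mul, norm_div, norm_inv, norm_mul, Complex.norm_exp_I_mul_ofReal]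
    simp only [Complex.norm_real, Complex.norm_I, one_mul, Real.norm_eq_abs, abs_of_pos hT]
    gcongr
    refine (norm_sub_le _ _).trans ?_
    rw [mul_assoc, mul_assoc, ← Complex.ofReal_mul, ← Complex.ofReal_mul,
      Complex.norm_exp_I_mul_ofReal, Complex.norm_exp_I_mul_ofReal]
    norm_num

lemma flow_intervalIntegrable {K : ℕ} (θ z : Fin K → ℝ) (f : C(UnitAddTorus (Fin K), ℂ))
    (a b : ℝ) : IntervalIntegrable (fun τ => f (torusFlow θ z τ)) volume a b :=
  (f.continuous.comp (torusFlow_continuous θ z)).intervalIntegrable a b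

lemma torus_integrable {K : ℕ} (f : C(UnitAddTorus (Fin K), ℂ)) :
    Integrable f (torusMeasure K) := by
  refine Integrable.of_bound f.continuous.aestronglyMeasurable ‖f‖ ?_
  exact Eventually.of_forall fun x => f.norm_coe_le_norm x

lemma equi_span {K : ℕ} (θ z : Fin K → ℝ) (hz : RationallyIndependent z)
    (f : C(UnitAddTorus (Fin K), ℂ))
    (hf : f ∈ Submodule.span ℂ (Set.range (UnitAddTorus.mFourier (d := Fin K)))) :
    Equidistributes θ z f := by
  induction hf using Submodule.span_induction with
  | mem x h => obtain ⟨n, rfl⟩ := h; exact equi_mFourier θ z hz n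
  | zero => simp [Equidistributes]
  | add f g _ _ hf hg =>
    unfold Equidistributes at *
    have h := hf.add hg
    simp only [ContinuousMap.add_apply]
    rw [integral_add (torus_integrable f) (torus_integrable g)]
    refine h.congr fun T => ?_
    rw [intervalIntegral.integral_add (flow_intervalIntegrable ..) (flow_intervalIntegrable ..),
      mul_add]
  | smul c f _ hf =>
    unfold Equidistributes at *
    have h := hf.const_mul c
    simp only [ContinuousMap.smul_apply, smul_eq_mul]
    rw [integral_const_mul]
    refine h.congr fun T => ?_
    rw [intervalIntegral.integral_const_mul]
    ring

lemma equi_all {K : ℕ} (θ z : Fin K → ℝ) (hz : RationallyIndependent z)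
    (f : C(UnitAddTorus (Fin K), ℂ)) : Equidistributes θ z f := by
  have hf : f ∈ closure
      ((Submodule.span ℂ (Set.range (UnitAddTorus.mFourier (d := Fin K))) :
        Submodule ℂ C(UnitAddTorus (Fin K), ℂ)) : Set C(UnitAddTorus (Fin K), ℂ)) := by
    rw [← Submodule.topologicalClosure_coe, UnitAddTorus.span_mFourier_closure_eq_top]
    trivial
  unfold Equidistributes
  rw [Metric.tendsto_nhds]
  intro ε hε
  obtain ⟨g, hg, hfg⟩ := Metric.mem_closure_iff.mp hf (ε / 3) (by positivity)
  have hgT := Metric.tendsto_nhds.mp (equi_span θ z hz g hg) (ε / 3) (by positivity)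
  rw [dist_eq_norm] at hfg
  filter_upwards [hgT, eventually_gt_atTop 0] with T h1 hT
  have hpt : ∀ x, ‖f x - g x‖ ≤ ‖f - g‖ := fun x => (f - g).norm_coe_le_norm x
  have h2 : dist ((T : ℂ)⁻¹ * ∫ τ in (0 : ℝ)..T, f (torusFlow θ z τ))
      ((T : ℂ)⁻¹ * ∫ τ in (0 : ℝ)..T, g (torusFlow θ z τ)) ≤ ‖f - g‖ := by
    rw [dist_eq_norm, ← mul_sub, ← intervalIntegral.integral_sub
      (flow_intervalIntegrable ..) (flow_intervalIntegrable ..), norm_mul, norm_inv,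
      Complex.norm_real, Real.norm_eq_abs, abs_of_pos hT, inv_mul_le_iff₀ hT]
    refine (intervalIntegral.norm_integral_le_of_norm_le_const fun x _ => hpt _).trans ?_
    rw [sub_zero, abs_of_pos hT, mul_comm]
  have h3 : dist (∫ x, g x ∂(torusMeasure K)) (∫ x, f x ∂(torusMeasure K)) ≤ ‖f - g‖ := by
    rw [dist_comm, dist_eq_norm, ← integral_sub (torus_integrable f) (torus_integrable g)]
    refine (norm_integral_le_of_norm_le_const (Eventually.of_forall hpt)).trans ?_
    simp
  have := dist_triangle4 ((T : ℂ)⁻¹ * ∫ τ in (0 : ℝ)..T, f (torusFlow θ z τ))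
    ((T : ℂ)⁻¹ * ∫ τ in (0 : ℝ)..T, g (torusFlow θ z τ))
    (∫ x, g x ∂(torusMeasure K)) (∫ x, f x ∂(torusMeasure K))
  linarith

/-- The one-variable factor on the circle. -/
noncomputable def circleFactor (s : ℝ) (x : UnitAddCircle) : ℂ :=
  Complex.exp (Complex.I * ((s * (fourier 1 x : ℂ).re : ℝ) : ℂ))

lemma circleFactor_continuous (s : ℝ) : Continuous (circleFactor s) := by
  unfold circleFactor
  fun_prop

lemma circleFactor_coe (s u : ℝ) : circleFactor s ((u / (2 * Real.pi) : ℝ) : UnitAddCircle) =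
    Complex.exp (Complex.I * ((s * Real.cos u : ℝ) : ℂ)) := by
  have hpi : (Real.pi : ℂ) ≠ 0 := by exact_mod_cast Real.pi_ne_zero
  unfold circleFactor
  rw [fourier_coe_apply]
  have : (2 * Real.pi * Complex.I * (1 : ℤ) * ((u / (2 * Real.pi) : ℝ) : ℂ) / (1 : ℝ) : ℂ)
      = u * Complex.I := by
    push_cast
    field_simp
  rw [this, Complex.exp_ofReal_mul_I_re]

lemma integral_circleFactor (s : ℝ) :
    ∫ x, circleFactor s x ∂AddCircle.haarAddCircle = besselJ0 s := by
  have hv : (volume : Measure UnitAddCircle) = AddCircle.haarAddCircle := by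
    rw [AddCircle.volume_eq_smul_haarAddCircle]; simp
  rw [← hv, ← UnitAddCircle.intervalIntegral_preimage (-(1 / 2))]
  unfold besselJ0
  simp_rw [← circleFactor_coe]
  rw [intervalIntegral.integral_comp_div (fun v : ℝ => circleFactor s (v : UnitAddCircle))
    (by positivity)]
  have hpi := Real.pi_ne_zero
  have hpi' : (Real.pi : ℂ) ≠ 0 := by exact_mod_cast Real.pi_ne_zero
  rw [show -Real.pi / (2 * Real.pi) = -(1 / 2) by field_simp,
    show Real.pi / (2 * Real.pi) = -(1 / 2) + 1 by field_simp; norm_num, Complex.real_smul,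
    ← mul_assoc, inv_mul_cancel₀, one_mul]
  exact_mod_cast (by positivity : (2 * Real.pi) ≠ 0)

theorem timeAveraged_charFun_tendsto_prod_besselJ0
    (K : ℕ) (hK : 0 < K) (r θ lam z : Fin K → ℝ) (hz : RationallyIndependent z) :
    Tendsto
      (fun T : ℝ => ((T : ℂ))⁻¹ *
        ∫ τ in (0 : ℝ)..T,
          Complex.exp (Complex.I *
            ((∑ k, lam k * r k * Real.cos (θ k + τ * z k) : ℝ) : ℂ)))
      atTop (nhds (∏ k, besselJ0 (lam k * r k))) := by

  let F : C(UnitAddTorus (Fin K), ℂ) :=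
    ⟨fun x => ∏ k, circleFactor (lam k * r k) (x k), by
      refine continuous_finsetProd _ fun k _ => ?_
      exact (circleFactor_continuous _).comp (continuous_apply k)⟩
  have h := equi_all θ z hz F
  unfold Equidistributes at h
  have hI : ∫ x, F x ∂(torusMeasure K) = ∏ k, besselJ0 (lam k * r k) := by
    have := integral_fintype_prod_eq_prod (𝕜 := ℂ)
      (fun k (x : UnitAddCircle) => circleFactor (lam k * r k) x)
      (μ := fun _ : Fin K => (AddCircle.haarAddCircle : Measure UnitAddCircle))
    refine this.trans ?_
    simp_rw [integral_circleFactor]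
  have hF : ∀ τ, F (torusFlow θ z τ) = Complex.exp (Complex.I *
      ((∑ k, lam k * r k * Real.cos (θ k + τ * z k) : ℝ) : ℂ)) := by
    intro τ
    change ∏ k, circleFactor (lam k * r k) (torusFlow θ z τ k) = _
    unfold torusFlow
    simp_rw [circleFactor_coe]
    rw [← Complex.exp_sum, ← Finset.mul_sum, Complex.ofReal_sum]
  rw [hI] at h
  simp_rw [hF] at h
  exact h
end

section
/- Let K be a positive integer, r_1,…,r_K, θ_1,…,θ_K real numbers, z_1,…,z_K rationally independent real numbers, and define x(τ) = Σ_{k=1}^K r_k cos(θ_k + τ z_k). Then for every λ ∈ ℝ, the empirical characteristic function converges: lim_{T→∞} (1/T) ∫_0^T e^{i λ x(τ)} dτ = Π_{k=1}^K J₀(λ r_k). -/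
open MeasureTheory Filter

lemma ecf_vol {K : ℕ} :
    (volume : Measure (UnitAddTorus (Fin K))).real Set.univ = 1 := by
  have : (volume : Measure (UnitAddTorus (Fin K))) Set.univ = 1 := by
    refine (Measure.pi_univ (fun _ : Fin K => (volume : Measure UnitAddCircle))).trans ?_
    simp
  simp [Measure.real, this]

lemma ecf_avg_tendsto {K : ℕ} (φ : ℝ → UnitAddTorus (Fin K)) (hφ : Continuous φ)
    (h : ∀ n : Fin K → ℤ, Tendsto
      (fun T : ℝ => ((T : ℂ))⁻¹ * ∫ τ in (0 : ℝ)..T, UnitAddTorus.mFourier n (φ τ)) atTop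
      (nhds (∫ t : UnitAddTorus (Fin K), UnitAddTorus.mFourier n t)))
    (f : C(UnitAddTorus (Fin K), ℂ)) :
    Tendsto (fun T : ℝ => ((T : ℂ))⁻¹ * ∫ τ in (0 : ℝ)..T, f (φ τ)) atTop
      (nhds (∫ t : UnitAddTorus (Fin K), f t)) := by
  have hint : ∀ g : C(UnitAddTorus (Fin K), ℂ), Integrable (fun t => g t)
      (volume : Measure (UnitAddTorus (Fin K))) := fun g =>
    g.continuous.integrable_of_hasCompactSupport (HasCompactSupport.of_compactSpace _)
  have hii : ∀ (g : C(UnitAddTorus (Fin K), ℂ)) (T : ℝ),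
      IntervalIntegrable (fun τ => g (φ τ)) volume 0 T := fun g T =>
    (g.continuous.comp hφ).intervalIntegrable _ _
  have hspan : ∀ g ∈ Submodule.span ℂ (Set.range (UnitAddTorus.mFourier (d := Fin K))),
      Tendsto (fun T : ℝ => ((T : ℂ))⁻¹ * ∫ τ in (0 : ℝ)..T, g (φ τ)) atTop
      (nhds (∫ t : UnitAddTorus (Fin K), g t)) := by
    intro g hg
    induction hg using Submodule.span_induction with
    | mem g hg => obtain ⟨n, rfl⟩ := hg; exact h n
    | zero => simp
    | add g₁ g₂ _ _ h₁ h₂ =>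
      have e := h₁.add h₂
      rw [← integral_add (hint g₁) (hint g₂)] at e
      refine e.congr fun T => ?_
      simp only [ContinuousMap.add_apply]
      rw [intervalIntegral.integral_add (hii g₁ T) (hii g₂ T), mul_add]
    | smul a g _ h₁ =>
      have e := h₁.const_mul a
      simp only [ContinuousMap.smul_apply, smul_eq_mul, intervalIntegral.integral_const_mul,
        integral_const_mul]
      refine e.congr fun T => ?_
      ring
  have hf : f ∈ (Submodule.span ℂ
      (Set.range (UnitAddTorus.mFourier (d := Fin K)))).topologicalClosure := by
    rw [UnitAddTorus.span_mFourier_closure_eq_top]; trivial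
  have hf' : f ∈ closure ((Submodule.span ℂ
      (Set.range (UnitAddTorus.mFourier (d := Fin K))) : Set C(UnitAddTorus (Fin K), ℂ))) := hf
  rw [Metric.tendsto_atTop]
  intro ε hε
  obtain ⟨g, hg, hfg⟩ := Metric.mem_closure_iff.mp hf' (ε / 3) (by positivity)
  rw [dist_eq_norm] at hfg
  have hpt : ∀ t, ‖f t - g t‖ ≤ ε / 3 := fun t =>
    ((f - g).norm_coe_le_norm t).trans hfg.le
  obtain ⟨N, hN⟩ := Metric.tendsto_atTop.mp (hspan g hg) (ε / 3) (by positivity)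
  refine ⟨max N 1, fun T hT => ?_⟩
  have hT0 : 0 < T := lt_of_lt_of_le one_pos ((le_max_right _ _).trans hT)
  have h1 := hN T ((le_max_left _ _).trans hT)
  have h2 : ‖(T : ℂ)⁻¹ * (∫ τ in (0 : ℝ)..T, f (φ τ)) -
      (T : ℂ)⁻¹ * (∫ τ in (0 : ℝ)..T, g (φ τ))‖ ≤ ε / 3 := by
    rw [← mul_sub, ← intervalIntegral.integral_sub (hii f T) (hii g T), norm_mul, norm_inv,
      Complex.norm_real, Real.norm_of_nonneg hT0.le]
    have := intervalIntegral.norm_integral_le_of_norm_le_const (a := (0 : ℝ)) (b := T)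
      (f := fun τ => f (φ τ) - g (φ τ)) (C := ε / 3) (fun τ _ => hpt _)
    rw [sub_zero, abs_of_pos hT0] at this
    calc T⁻¹ * _ ≤ T⁻¹ * (ε / 3 * T) := by gcongr
      _ = ε / 3 := by field_simp
  have h3 : ‖(∫ t : UnitAddTorus (Fin K), g t) - ∫ t : UnitAddTorus (Fin K), f t‖ ≤ ε / 3 := by
    rw [← integral_sub (hint g) (hint f)]
    have := norm_integral_le_of_norm_le_const (μ := (volume : Measure (UnitAddTorus (Fin K))))
      (f := fun t => g t - f t) (C := ε / 3)
      (Eventually.of_forall fun t => by rw [norm_sub_rev]; exact hpt t)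
    simpa [ecf_vol] using this
  rw [dist_eq_norm] at h1 ⊢
  calc _ = ‖((T : ℂ)⁻¹ * (∫ τ in (0 : ℝ)..T, f (φ τ)) -
      (T : ℂ)⁻¹ * (∫ τ in (0 : ℝ)..T, g (φ τ))) + ((T : ℂ)⁻¹ * (∫ τ in (0 : ℝ)..T, g (φ τ)) -
        ∫ t : UnitAddTorus (Fin K), g t) + ((∫ t : UnitAddTorus (Fin K), g t) -
        ∫ t : UnitAddTorus (Fin K), f t)‖ := by congr 1; ring
    _ ≤ _ := norm_add₃_le
    _ < ε := by linarith

lemma ecf_integral_fourier (n : ℤ) (hn : n ≠ 0) :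
    ∫ t : UnitAddCircle, (fourier n t : ℂ) = 0 := by
  rw [← UnitAddCircle.intervalIntegral_preimage 0]
  have hc : (2 * Real.pi * Complex.I * n : ℂ) ≠ 0 := by
    have : (n : ℂ) ≠ 0 := by exact_mod_cast hn
    simp [this, Real.pi_ne_zero]
  have : ∀ a : ℝ, (fourier n (a : UnitAddCircle) : ℂ)
      = Complex.exp ((2 * Real.pi * Complex.I * n) * a) := by
    intro a; rw [fourier_coe_apply]; simp
  simp_rw [this]
  rw [integral_exp_mul_complex hc]
  have e := Complex.exp_int_mul_two_pi_mul_I n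
  have e2 : (2 * Real.pi * Complex.I * n : ℂ) * ((0 + 1 : ℝ) : ℂ)
      = n * (2 * Real.pi * Complex.I) := by push_cast; ring
  rw [e2, e]; simp

lemma ecf_integral_mFourier {K : ℕ} (n : Fin K → ℤ) (hn : n ≠ 0) :
    ∫ t : UnitAddTorus (Fin K), UnitAddTorus.mFourier n t = 0 := by
  obtain ⟨i, hi⟩ := Function.ne_iff.mp hn
  have := MeasureTheory.integral_fintype_prod_volume_eq_prod
    (f := fun (i : Fin K) (t : UnitAddCircle) => (fourier (n i) t : ℂ))
  refine Eq.trans this ?_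
  exact Finset.prod_eq_zero (Finset.mem_univ i) (ecf_integral_fourier _ hi)

lemma ecf_exp_avg (w : ℝ) (hw : w ≠ 0) :
    Tendsto (fun T : ℝ => ((T : ℂ))⁻¹ * ∫ τ in (0 : ℝ)..T, Complex.exp ((Complex.I * w) * τ))
      atTop (nhds 0) := by
  have hc : (Complex.I * w : ℂ) ≠ 0 := by simp [hw]
  simp_rw [integral_exp_mul_complex hc]
  have h0 : Tendsto (fun T : ℝ => T⁻¹ * (2 / |w|)) atTop (nhds 0) := by
    simpa using tendsto_inv_atTop_zero.mul_const (2 / |w|)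
  refine squeeze_zero_norm' ?_ h0
  filter_upwards [eventually_gt_atTop 0] with T hT
  rw [norm_mul, norm_inv, norm_div, Complex.norm_real, Real.norm_of_nonneg hT.le]
  have e1 : ‖(Complex.I * w : ℂ)‖ = |w| := by simp
  have e2 : ‖Complex.exp (Complex.I * w * T)‖ = 1 := by
    have : Complex.I * w * T = ((w * T : ℝ) : ℂ) * Complex.I := by push_cast; ring
    rw [this, Complex.norm_exp_ofReal_mul_I]
  rw [e1]
  gcongr
  refine (norm_sub_le _ _).trans ?_
  rw [e2]; simp; norm_num

lemma ecf_bessel (s : ℝ) :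
    ∫ t : UnitAddCircle, Complex.exp (Complex.I * ((s * (fourier 1 t : ℂ).re : ℝ) : ℂ))
      = besselJ0 s := by
  rw [← UnitAddCircle.intervalIntegral_preimage (-(1 / 2))]
  have : ∀ a : ℝ, (fourier 1 (a : UnitAddCircle) : ℂ).re = Real.cos (2 * Real.pi * a) := by
    intro a
    rw [fourier_coe_apply]
    have : (2 * Real.pi * Complex.I * (1 : ℤ) * a / (1 : ℝ) : ℂ)
      = ((2 * Real.pi * a : ℝ) : ℂ) * Complex.I := by push_cast; ring
    rw [this, Complex.exp_ofReal_mul_I_re]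
  simp_rw [this]
  rw [intervalIntegral.integral_comp_mul_left
    (fun u : ℝ => Complex.exp (Complex.I * ((s * Real.cos u : ℝ) : ℂ)))
    (by positivity : (2 * Real.pi : ℝ) ≠ 0), besselJ0, Complex.real_smul, Complex.ofReal_inv]
  congr 2 <;> ring

/-- The empirical characteristic function of a path `x(τ) = Σ_k r_k cos(θ_k + τ z_k)`
with rationally independent frequencies converges to `Π_k J₀(λ r_k)`. -/
theorem empirical_charFun_tendsto_prod_besselJ0
    (K : ℕ) (hK : 0 < K) (r θ z : Fin K → ℝ) (hz : RationallyIndependent z)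
    (x : ℝ → ℝ) (hx : ∀ τ, x τ = ∑ k, r k * Real.cos (θ k + τ * z k)) (lam : ℝ) :
    Tendsto
      (fun T : ℝ => ((T : ℂ))⁻¹ *
        ∫ τ in (0 : ℝ)..T, Complex.exp (Complex.I * ((lam * x τ : ℝ) : ℂ)))
      atTop (nhds (∏ k, besselJ0 (lam * r k))) := by
  have hpi : (Real.pi : ℝ) ≠ 0 := Real.pi_ne_zero
  let φ : ℝ → UnitAddTorus (Fin K) := fun τ k => (((θ k + τ * z k) / (2 * Real.pi) : ℝ) : UnitAddCircle)
  have hφ : Continuous φ := by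
    refine continuous_pi fun k => ?_
    exact (AddCircle.continuous_mk' 1).comp (by fun_prop)
  have hF : ∀ (m : ℤ) (k : Fin K) (τ : ℝ), (fourier m (φ τ k) : ℂ)
      = Complex.exp (Complex.I * ((m * (θ k + τ * z k) : ℝ) : ℂ)) := by
    intro m k τ
    simp only [φ]
    rw [fourier_coe_apply]
    congr 1
    have : (Real.pi : ℂ) ≠ 0 := by exact_mod_cast hpi
    push_cast
    field_simp
  let f : C(UnitAddTorus (Fin K), ℂ) := ⟨fun t => ∏ k, Complex.exp
    (Complex.I * ((lam * r k * (fourier 1 (t k) : ℂ).re : ℝ) : ℂ)), by fun_prop⟩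
  have key := ecf_avg_tendsto φ hφ ?_ f
  · have e1 : ∫ t : UnitAddTorus (Fin K), f t = ∏ k, besselJ0 (lam * r k) := by
      refine Eq.trans (MeasureTheory.integral_fintype_prod_volume_eq_prod
        (f := fun (k : Fin K) (t : UnitAddCircle) => Complex.exp
          (Complex.I * ((lam * r k * (fourier 1 t : ℂ).re : ℝ) : ℂ)))) ?_
      exact Finset.prod_congr rfl fun k _ => ecf_bessel _
    rw [e1] at key
    refine key.congr fun T => ?_
    congr 1
    refine intervalIntegral.integral_congr fun τ _ => ?_
    simp only [f, ContinuousMap.coe_mk, hF]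
    rw [← Complex.exp_sum, ← Finset.mul_sum, hx, ← Complex.ofReal_sum, Finset.mul_sum]
    congr 3
    refine Finset.sum_congr rfl fun k _ => ?_
    rw [mul_comm Complex.I, Complex.exp_ofReal_mul_I_re]
    push_cast
    ring_nf
  · intro n
    by_cases hn : n = 0
    · subst hn
      simp only [UnitAddTorus.mFourier_zero, ContinuousMap.one_apply]
      refine tendsto_const_nhds.congr' ?_
      filter_upwards [eventually_gt_atTop 0] with T hT
      have : (T : ℂ) ≠ 0 := by exact_mod_cast hT.ne'
      simp [this, ecf_vol]
    · rw [ecf_integral_mFourier n hn]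
      have hw : (∑ k, (n k : ℝ) * z k) ≠ 0 := fun h => hn (funext (hz n h))
      have := (ecf_exp_avg _ hw).const_mul
        (Complex.exp (Complex.I * ((∑ k, (n k : ℝ) * θ k : ℝ) : ℂ)))
      rw [mul_zero] at this
      refine this.congr fun T => ?_
      rw [mul_left_comm, ← intervalIntegral.integral_const_mul]
      congr 1
      refine intervalIntegral.integral_congr fun τ _ => ?_
      simp only [UnitAddTorus.mFourier, ContinuousMap.coe_mk, hF]
      rw [← Complex.exp_sum, ← Complex.exp_add, ← Finset.mul_sum, ← Complex.ofReal_sum]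
      congr 1
      rw [mul_assoc, ← mul_add]
      congr 1
      rw [← Complex.ofReal_mul, ← Complex.ofReal_add, Finset.sum_mul, ← Finset.sum_add_distrib]
      congr 1
      refine Finset.sum_congr rfl fun k _ => ?_
      ring
end

section
/- Let K be a positive integer, r_1,…,r_K, θ_1,…,θ_K real numbers, z_1,…,z_K rationally independent real numbers, and define x(τ) = Σ_{k=1}^K r_k cos(θ_k + τ z_k). Let p > 0 and let h : ℝ → ℝ be given by an absolutely convergent Fourier series h(y) = Σ_{n∈ℤ} c_n e^{i (2π/p) n y} with Σ_{n∈ℤ} |c_n| < ∞. Then lim_{T→∞} (1/T) ∫_0^T h(x(τ)) dτ = Σ_{n∈ℤ} c_n Π_{k=1}^K J₀((2π/p) n r_k). -/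
open MeasureTheory Filter

open UnitAddTorus in
lemma tb_integral_fourier (n : ℤ) (hn : n ≠ 0) : ∫ t : AddCircle (1:ℝ), fourier n t = 0 := by
  rw [← AddCircle.intervalIntegral_preimage 1 0]
  simp only [fourier_coe_apply]
  have hc : (2 * (Real.pi:ℂ) * Complex.I * n) ≠ 0 := by
    simp [Real.pi_ne_zero, hn]
  have := integral_exp_mul_complex (a := 0) (b := 0 + 1) hc
  simp only [Complex.ofReal_one, div_one]
  rw [this]
  have h1 : Complex.exp (2 * (Real.pi:ℂ) * Complex.I * n) = 1 := by
    rw [mul_comm]; exact Complex.exp_int_mul_two_pi_mul_I n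
  simp [h1]

/-- The measure on the torus. -/
noncomputable def tbMu (K : ℕ) : Measure (UnitAddTorus (Fin K)) :=
  Measure.pi (fun _ => (volume : Measure (AddCircle (1:ℝ))))

instance (K : ℕ) : IsProbabilityMeasure (tbMu K) := by
  have : IsProbabilityMeasure (volume : Measure (AddCircle (1:ℝ))) := ⟨by simp⟩
  unfold tbMu; infer_instance

/-- The path on the torus. -/
noncomputable def tbPath {K : ℕ} (θ z : Fin K → ℝ) (τ : ℝ) : UnitAddTorus (Fin K) :=
  fun k => (((θ k + τ * z k) / (2 * Real.pi) : ℝ) : AddCircle (1:ℝ))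

lemma tbPath_continuous {K : ℕ} (θ z : Fin K → ℝ) : Continuous (tbPath θ z) := by
  refine continuous_pi fun k => ?_
  exact (AddCircle.continuous_mk' 1).comp (by fun_prop)

lemma tb_int_norm {K : ℕ} (f : C(UnitAddTorus (Fin K), ℂ)) : ‖∫ t, f t ∂(tbMu K)‖ ≤ ‖f‖ := by
  have := norm_integral_le_of_norm_le_const (μ := tbMu K) (f := f) (C := ‖f‖)
    (Eventually.of_forall fun t => f.norm_coe_le_norm t)
  simpa using this

lemma tb_avg_norm {K : ℕ} (θ z : Fin K → ℝ) (f : C(UnitAddTorus (Fin K), ℂ)) (T : ℝ) :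
    ‖(T:ℂ)⁻¹ * ∫ τ in (0:ℝ)..T, f (tbPath θ z τ)‖ ≤ ‖f‖ := by
  have h1 := intervalIntegral.norm_integral_le_of_norm_le_const (a := 0) (b := T)
    (f := fun τ => f (tbPath θ z τ)) (C := ‖f‖) (fun τ _ => f.norm_coe_le_norm _)
  rw [norm_mul, norm_inv, Complex.norm_real, Real.norm_eq_abs]
  rw [sub_zero] at h1
  rcases eq_or_ne T 0 with rfl | hT
  · simp
  · have : 0 < |T| := abs_pos.mpr hT
    rw [inv_mul_le_iff₀ this]; linarith

lemma tb_integrable {K : ℕ} (f : C(UnitAddTorus (Fin K), ℂ)) : Integrable f (tbMu K) :=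
  f.continuous.integrable_of_hasCompactSupport (HasCompactSupport.of_compactSpace _)

lemma tb_mFourier_path {K : ℕ} (θ z : Fin K → ℝ) (m : Fin K → ℤ) (τ : ℝ) :
    UnitAddTorus.mFourier m (tbPath θ z τ) =
      Complex.exp (Complex.I * ((∑ k, (m k:ℝ) * θ k : ℝ) : ℂ)) *
      Complex.exp ((Complex.I * ((∑ k, (m k:ℝ) * z k : ℝ) : ℂ)) * τ) := by
  simp only [UnitAddTorus.mFourier, ContinuousMap.coe_mk, tbPath, fourier_coe_apply]
  rw [← Complex.exp_sum, ← Complex.exp_add]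
  congr 1
  push_cast
  rw [Finset.mul_sum, Finset.mul_sum, Finset.sum_mul, ← Finset.sum_add_distrib]
  refine Finset.sum_congr rfl fun k _ => ?_
  have : (Real.pi : ℂ) ≠ 0 := by exact_mod_cast Real.pi_ne_zero
  field_simp

lemma tb_mFourier {K : ℕ} (θ z : Fin K → ℝ) (hz : RationallyIndependent z) (m : Fin K → ℤ) :
    Tendsto (fun T : ℝ => (T:ℂ)⁻¹ * ∫ τ in (0:ℝ)..T, UnitAddTorus.mFourier m (tbPath θ z τ)) atTop
      (nhds (∫ t, UnitAddTorus.mFourier m t ∂(tbMu K))) := by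
  by_cases hm : m = 0
  · subst hm
    simp only [UnitAddTorus.mFourier_zero, ContinuousMap.one_apply]
    refine tendsto_const_nhds.congr' ?_
    filter_upwards [eventually_gt_atTop 0] with T hT
    have : (T:ℂ) ≠ 0 := by exact_mod_cast hT.ne'
    simp [this]
  · have h0 : ∫ t, UnitAddTorus.mFourier m t ∂(tbMu K) = 0 := by
      simp only [UnitAddTorus.mFourier, ContinuousMap.coe_mk, tbMu]
      rw [MeasureTheory.integral_fintype_prod_eq_prod
        (f := fun i (t : AddCircle (1:ℝ)) => fourier (m i) t)]
      obtain ⟨i, hi⟩ := Function.ne_iff.mp hm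
      exact Finset.prod_eq_zero (Finset.mem_univ i) (tb_integral_fourier _ hi)
    rw [h0]
    have hw : (∑ k, (m k:ℝ) * z k) ≠ 0 := fun h => hm (funext (hz m h))
    simp only [tb_mFourier_path]
    set w : ℝ := ∑ k, (m k:ℝ) * z k
    set a : ℂ := Complex.exp (Complex.I * ((∑ k, (m k:ℝ) * θ k : ℝ) : ℂ))
    have hw' : Complex.I * (w:ℂ) ≠ 0 := by simp [hw]
    simp only [intervalIntegral.integral_const_mul, integral_exp_mul_complex hw']
    have hinv : Tendsto (fun T : ℝ => (T:ℂ)⁻¹) atTop (nhds 0) := by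
      have := (Complex.continuous_ofReal.tendsto 0).comp tendsto_inv_atTop_zero
      simpa [Function.comp_def] using this
    refine hinv.zero_mul_isBoundedUnder_le ?_
    refine isBoundedUnder_of ⟨‖a‖ * (2 / ‖Complex.I * (w:ℂ)‖), fun T => ?_⟩
    simp only [Function.comp, norm_mul, norm_div]
    gcongr
    refine (norm_sub_le _ _).trans ?_
    have e1 : ‖Complex.exp (Complex.I * w * T)‖ = 1 := by
      rw [show Complex.I * w * T = ((w * T : ℝ) : ℂ) * Complex.I by push_cast; ring]
      exact Complex.norm_exp_ofReal_mul_I _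
    rw [e1]; norm_num

lemma tb_equidist {K : ℕ} (θ z : Fin K → ℝ) (hz : RationallyIndependent z)
    (f : C(UnitAddTorus (Fin K), ℂ)) :
    Tendsto (fun T : ℝ => (T:ℂ)⁻¹ * ∫ τ in (0:ℝ)..T, f (tbPath θ z τ)) atTop
      (nhds (∫ t, f t ∂(tbMu K))) := by
  have hii : ∀ (g : C(UnitAddTorus (Fin K), ℂ)) (T : ℝ),
      IntervalIntegrable (fun τ => g (tbPath θ z τ)) volume 0 T := fun g T =>
    (g.continuous.comp (tbPath_continuous θ z)).intervalIntegrable _ _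
  have hspan : ∀ g ∈ Submodule.span ℂ (Set.range (UnitAddTorus.mFourier (d := Fin K))),
      Tendsto (fun T : ℝ => (T:ℂ)⁻¹ * ∫ τ in (0:ℝ)..T, g (tbPath θ z τ)) atTop
      (nhds (∫ t, g t ∂(tbMu K))) := by
    intro g hg
    induction hg using Submodule.span_induction with
    | mem g hg => obtain ⟨m, rfl⟩ := hg; exact tb_mFourier θ z hz m
    | zero => simp
    | add g g' _ _ h h' =>
      simp only [ContinuousMap.add_apply]
      rw [integral_add (tb_integrable g) (tb_integrable g')]
      refine (h.add h').congr fun T => ?_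
      rw [intervalIntegral.integral_add (hii g T) (hii g' T)]; ring
    | smul a g _ h =>
      simp only [ContinuousMap.smul_apply, smul_eq_mul]
      rw [integral_const_mul]
      refine (h.const_mul a).congr fun T => ?_
      rw [intervalIntegral.integral_const_mul]; ring
  have hf : f ∈ closure (Submodule.span ℂ (Set.range (UnitAddTorus.mFourier (d := Fin K))) :
      Set C(UnitAddTorus (Fin K), ℂ)) := by
    rw [← Submodule.topologicalClosure_coe, UnitAddTorus.span_mFourier_closure_eq_top]; trivial
  rw [Metric.tendsto_nhds]
  intro ε hε
  obtain ⟨g, hg, hfg⟩ := Metric.mem_closure_iff.mp hf (ε / 3) (by positivity)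
  filter_upwards [Metric.tendsto_nhds.mp (hspan g hg) (ε / 3) (by positivity)] with T hT
  have h1 := tb_avg_norm θ z (f - g) T
  have h2 := tb_int_norm (f - g)
  simp only [ContinuousMap.sub_apply] at h1 h2
  rw [intervalIntegral.integral_sub (hii f T) (hii g T), mul_sub] at h1
  rw [integral_sub (tb_integrable f) (tb_integrable g), norm_sub_rev] at h2
  rw [dist_eq_norm] at *
  refine lt_of_le_of_lt (norm_sub_le_norm_sub_add_norm_sub _
    ((T:ℂ)⁻¹ * ∫ τ in (0:ℝ)..T, g (tbPath θ z τ)) _) ?_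
  have h3 := norm_sub_le_norm_sub_add_norm_sub
    ((T:ℂ)⁻¹ * ∫ τ in (0:ℝ)..T, g (tbPath θ z τ)) (∫ t, g t ∂(tbMu K)) (∫ t, f t ∂(tbMu K))
  linarith

/-- One factor on the circle. -/
noncomputable def tbG (s : ℝ) : C(AddCircle (1:ℝ), ℂ) where
  toFun t := Complex.exp (Complex.I * ((s * (fourier 1 t).re : ℝ) : ℂ))
  continuous_toFun := by fun_prop

lemma tbG_coe (s u : ℝ) : tbG s (u : AddCircle (1:ℝ)) =
    Complex.exp (Complex.I * ((s * Real.cos (2 * Real.pi * u) : ℝ) : ℂ)) := by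
  simp only [tbG, ContinuousMap.coe_mk, fourier_coe_apply]
  rw [show 2 * (Real.pi:ℂ) * Complex.I * (1:ℤ) * u / (1:ℝ) =
    ((2 * Real.pi * u : ℝ) : ℂ) * Complex.I by push_cast; ring, Complex.exp_ofReal_mul_I_re]

lemma tbG_norm (s : ℝ) (t : AddCircle (1:ℝ)) : ‖tbG s t‖ = 1 := by
  simp only [tbG, ContinuousMap.coe_mk]
  rw [mul_comm]
  exact Complex.norm_exp_ofReal_mul_I _

lemma tbG_integral (s : ℝ) : ∫ t, tbG s t = besselJ0 s := by
  rw [← AddCircle.intervalIntegral_preimage 1 (-(1/2)), besselJ0]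
  simp only [tbG_coe]
  have := intervalIntegral.integral_comp_mul_left (a := -(1/2)) (b := -(1/2) + 1)
    (fun u : ℝ => Complex.exp (Complex.I * ((s * Real.cos u : ℝ) : ℂ)))
    (c := 2 * Real.pi) (by positivity)
  rw [this, Complex.real_smul, Complex.ofReal_inv]
  congr 2 <;> ring

/-- The product function on the torus. -/
noncomputable def tbF {K : ℕ} (s : Fin K → ℝ) : C(UnitAddTorus (Fin K), ℂ) where
  toFun t := ∏ k, tbG (s k) (t k)
  continuous_toFun := by fun_prop

lemma tbF_norm {K : ℕ} (s : Fin K → ℝ) (t : UnitAddTorus (Fin K)) : ‖tbF s t‖ = 1 := by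
  simp [tbF, tbG_norm]

lemma tbF_integral {K : ℕ} (s : Fin K → ℝ) : ∫ t, tbF s t ∂(tbMu K) = ∏ k, besselJ0 (s k) := by
  simp only [tbF, ContinuousMap.coe_mk, tbMu]
  rw [MeasureTheory.integral_fintype_prod_eq_prod
        (f := fun i (t : AddCircle (1:ℝ)) => tbG (s i) t)]
  simp only [tbG_integral]

/-- Non-ergodic limit of the time-average of a `p`-periodic observable with absolutely
convergent Fourier series applied to a path `x(τ) = Σ_k r_k cos(θ_k + τ z_k)` with
rationally independent frequencies. -/
theorem timeAverage_periodic_observable_tendsto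
    (K : ℕ) (hK : 0 < K) (r θ z : Fin K → ℝ) (hz : RationallyIndependent z)
    (x : ℝ → ℝ) (hx : ∀ τ, x τ = ∑ k, r k * Real.cos (θ k + τ * z k))
    (p : ℝ) (hp : 0 < p) (c : ℤ → ℂ) (hc : Summable fun n : ℤ => ‖c n‖)
    (h : ℝ → ℝ)
    (hh : ∀ y : ℝ, (h y : ℂ) =
      ∑' n : ℤ, c n * Complex.exp (Complex.I * ((2 * Real.pi / p * n * y : ℝ) : ℂ))) :
    Tendsto
      (fun T : ℝ => ((T : ℂ))⁻¹ * ∫ τ in (0 : ℝ)..T, (h (x τ) : ℂ))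
      atTop
      (nhds (∑' n : ℤ, c n * ∏ k, besselJ0 (2 * Real.pi / p * n * r k))) := by
  set F : ℤ → C(UnitAddTorus (Fin K), ℂ) :=
    fun n => c n • tbF (fun k => 2 * Real.pi / p * n * r k) with hF
  have hFle : ∀ n, ‖F n‖ ≤ ‖c n‖ := fun n => by
    refine (ContinuousMap.norm_le _ (norm_nonneg _)).mpr fun t => ?_
    simp [hF, tbF_norm]
  have hFs : Summable F := Summable.of_norm_bounded hc hFle
  have hpath : ∀ τ, (h (x τ) : ℂ) = (∑' n, F n) (tbPath θ z τ) := by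
    intro τ
    rw [hh, ← ContinuousMap.tsum_apply hFs]
    refine tsum_congr fun n => ?_
    simp only [hF, ContinuousMap.smul_apply, smul_eq_mul, tbF, ContinuousMap.coe_mk, tbPath, tbG_coe]
    rw [← Complex.exp_sum, hx]
    congr 2
    rw [← Finset.mul_sum, ← Complex.ofReal_sum, Finset.mul_sum]
    congr 2
    refine Finset.sum_congr rfl fun k _ => ?_
    rw [mul_div_cancel₀ _ (by positivity)]
    ring
  simp only [hpath]
  have key := tb_equidist θ z hz (∑' n, F n)
  have hint : ∫ t, (∑' n, F n) t ∂(tbMu K) =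
      ∑' n : ℤ, c n * ∏ k, besselJ0 (2 * Real.pi / p * n * r k) := by
    simp only [← ContinuousMap.tsum_apply hFs]
    rw [← integral_tsum_of_summable_integral_norm (fun n => tb_integrable (F n))]
    · refine tsum_congr fun n => ?_
      simp only [hF, ContinuousMap.smul_apply, smul_eq_mul]
      rw [integral_const_mul, tbF_integral]
    · refine hc.congr fun n => ?_
      simp [hF, tbF_norm]
  rwa [hint] at key
end
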